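/- For natural numbers a ≥ b ≥ c > 0, the number of ways to play Stanley Solitaire to completion starting from the position [b, c, a] equals ( (a+b+c)! / ( (a+3)! · (b+1)! · c! ) ) · ( a²b − a²c + ab² − 2abc + ac² − b²c + bc² + a² + 5ab − 6ac + 3b² − 6bc + 3c² + 4a + 6b − 9c + 3 ) · (a − b + 2). -/

import Mathlib

/-- Delete all leading and trailing zeros from a list of naturals. -/
def trim (l : List ℕ) : List ℕ :=
  ((l.dropWhile (· == 0)).reverse.dropWhile (· == 0)).reverse

/-- Apply one legal move of Stanley Solitaire to the position `p`, returning `none` if the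
move is illegal.  The move `some i` (for `0 ≤ i < k - 1`, 0-indexed) exchanges the adjacent
piles at positions `i` and `i+1`, which is legal when the left pile is strictly larger, and
eats one candy from the larger pile (now on the right).  The move `none` exchanges the last
pile with the implied empty pile to its right, eating one candy.  In both cases all leading
and trailing zeros are deleted afterwards. -/
def applyMove (p : List ℕ) (m : Option ℕ) : Option (List ℕ) :=
  match m with
  | some i =>
      if i + 1 < p.length ∧ p.getD (i + 1) 0 < p.getD i 0 then
        some (trim ((p.set i (p.getD (i + 1) 0)).set (i + 1) (p.getD i 0 - 1)))
      else none
  | none =>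
      if p = [] then none
      else some (trim (p.dropLast ++ [0, p.getD (p.length - 1) 0 - 1]))

/-- Play the sequence of moves `ms` starting from position `p`, returning the final position,
or `none` if some move along the way is illegal. -/
def run : List ℕ → List (Option ℕ) → Option (List ℕ)
  | p, [] => some p
  | p, m :: ms => (applyMove p m).bind fun q => run q ms

/-- `numPlays p` is the number of ways to play Stanley Solitaire to completion from the
position `p`: the number of finite sequences of legal moves starting at `p` and ending at
the empty position `[]`. -/
noncomputable def numPlays (p : List ℕ) : ℕ :=
  Nat.card {ms : List (Option ℕ) // run p ms = some []}

/-- The sequence `f` after exchanging the entries at `j` and `j + 1` and eating one candy. -/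
def swapEat (f : ℕ → ℕ) (j : ℕ) : ℕ → ℕ :=
  fun i => if i = j then f (j + 1) else if i = j + 1 then f j - 1 else f i

/-- `p` does not end with a zero, and `f` is `p` preceded by some zeros and followed by zeros. -/
def Represents (p : List ℕ) (f : ℕ → ℕ) : Prop :=
  (p = [] ∨ p.getD (p.length - 1) 0 ≠ 0) ∧
    ∃ k, (∀ i < k, f i = 0) ∧ ∀ i, f (i + k) = p.getD i 0

/-- Every position represented by `f` has exactly `x` plays to completion. -/
def HasCount (f : ℕ → ℕ) (x : ℚ) : Prop :=
  ∀ p, Represents p f → ∃ s : Finset (List (Option ℕ)), (s.card : ℚ) = x ∧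
    ∀ ms, ms ∈ s ↔ run p ms = some []

/-- The move of the game that acts on the pile with index `i`. -/
def moveAt (p : List ℕ) (i : ℕ) : Option ℕ :=
  if i + 1 < p.length then some i else none

lemma dropWhile_zero_eq (l : List ℕ) :
    ∃ k, l = List.replicate k 0 ++ l.dropWhile (· == 0) := by
  induction l with
  | nil => exact ⟨0, rfl⟩
  | cons a l ih =>
    obtain ⟨k, hk⟩ := ih
    by_cases ha : a = 0
    · subst ha
      refine ⟨k + 1, ?_⟩
      simpa [List.dropWhile_cons, List.replicate_succ] using hk
    · exact ⟨0, by simp [ha]⟩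

lemma trim_eq (l : List ℕ) :
    ∃ k m, l = List.replicate k 0 ++ trim l ++ List.replicate m 0 := by
  obtain ⟨k, hk⟩ := dropWhile_zero_eq l
  obtain ⟨m, hm⟩ := dropWhile_zero_eq (l.dropWhile (· == 0)).reverse
  refine ⟨k, m, ?_⟩
  have h := congrArg List.reverse hm
  rw [List.reverse_reverse, List.reverse_append, List.reverse_replicate] at h
  rw [List.append_assoc]
  unfold trim
  rw [← h]
  exact hk

lemma trim_last (l : List ℕ) :
    trim l = [] ∨ (trim l).getD ((trim l).length - 1) 0 ≠ 0 := by
  unfold trim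
  generalize (l.dropWhile (· == 0)).reverse = r
  rcases h : r.dropWhile (· == 0) with _ | ⟨a, t⟩
  · simp
  · right
    have h' := List.head_dropWhile_not (fun x : ℕ => x == 0) (l := r) (by simp [h])
    simp only [h, List.head_cons] at h'
    simpa [List.getD_eq_getElem?_getD] using h'

lemma represents_trim {l : List ℕ} {f : ℕ → ℕ} {k : ℕ} (h0 : ∀ i < k, f i = 0)
    (h : ∀ i, f (i + k) = l.getD i 0) : Represents (trim l) f := by
  refine ⟨trim_last l, ?_⟩
  obtain ⟨a, b, hl⟩ := trim_eq l
  refine ⟨a + k, fun i hi => ?_, fun i => ?_⟩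
  · by_cases hik : i < k
    · exact h0 i hik
    · obtain ⟨d, rfl⟩ : ∃ d, i = d + k := ⟨i - k, by omega⟩
      rw [h, hl, List.append_assoc, List.getD_append _ _ _ _ (by simp; omega)]
      simp [List.getD_eq_getElem?_getD, List.getElem?_replicate]
      split <;> rfl
  · have hl' : l.getD (i + a) 0 = (trim l ++ List.replicate b 0).getD i 0 := by
      conv_lhs => rw [hl, List.append_assoc, List.getD_append_right _ _ _ _ (by simp)]
      simp only [List.length_replicate, Nat.add_sub_cancel]
    rw [← add_assoc, h, hl']
    by_cases hi : i < (trim l).length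
    · rw [List.getD_append _ _ _ _ hi]
    · rw [List.getD_append_right _ _ _ _ (by omega),
        List.getD_eq_default (trim l) 0 (by omega)]
      simp [List.getD_eq_getElem?_getD, List.getElem?_replicate]
      split <;> rfl

lemma lt_length_of_descent {p : List ℕ} {i : ℕ} (h : p.getD (i + 1) 0 < p.getD i 0) :
    i < p.length := by
  by_contra hi
  rw [List.getD_eq_default p 0 (by omega : p.length ≤ i)] at h
  omega

lemma applyMove_moveAt {p : List ℕ} {i : ℕ} (h : p.getD (i + 1) 0 < p.getD i 0) :
    ∃ l, applyMove p (moveAt p i) = some (trim l) ∧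
      ∀ n, l.getD n 0 = swapEat (fun n => p.getD n 0) i n := by
  have hi := lt_length_of_descent h
  by_cases hi' : i + 1 < p.length
  · refine ⟨_, by simp only [moveAt, hi', applyMove, if_true, h, and_self]; rfl, fun n => ?_⟩
    simp only [swapEat, List.getD_eq_getElem?_getD, List.getElem?_set, List.length_set]
    split_ifs <;> first | omega | rfl
  · have hp : p ≠ [] := by rintro rfl; simp at hi
    obtain rfl : i = p.length - 1 := by omega
    refine ⟨_, by simp only [moveAt, hi', applyMove, if_false, hp]; rfl, fun n => ?_⟩
    rcases lt_trichotomy n (p.length - 1) with hn | hn | hn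
    · rw [List.getD_append _ _ _ _ (by simpa using hn)]
      have h1 : n ≠ p.length - 1 := by omega
      have h2 : n ≠ p.length - 1 + 1 := by omega
      simp only [swapEat, h1, h2, if_false, List.getD_eq_getElem?_getD, List.getElem?_dropLast, hn,
        if_true]
    · rw [List.getD_append_right _ _ _ _ (by simp; omega)]
      subst hn
      simp only [swapEat, List.length_dropLast, Nat.sub_self, if_true]
      rw [List.getD_eq_default p 0 (by omega : p.length ≤ p.length - 1 + 1)]
      rfl
    · rw [List.getD_append_right _ _ _ _ (by simp; omega)]
      have h1 : n ≠ p.length - 1 := by omega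
      simp only [swapEat, h1, if_false, List.length_dropLast]
      obtain ⟨d, rfl⟩ : ∃ d, n = p.length - 1 + 1 + d := ⟨n - (p.length - 1 + 1), by omega⟩
      rw [show p.length - 1 + 1 + d - (p.length - 1) = d + 1 by omega]
      rcases d with _ | d
      · simp
      · rw [if_neg (by omega),
          List.getD_eq_default p 0 (by omega : p.length ≤ p.length - 1 + 1 + (d + 1))]
        simp

lemma exists_moveAt_of_applyMove {p q : List ℕ} {m : Option ℕ}
    (hp : p = [] ∨ p.getD (p.length - 1) 0 ≠ 0) (h : applyMove p m = some q) :
    ∃ i, p.getD (i + 1) 0 < p.getD i 0 ∧ m = moveAt p i := by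
  rcases m with _ | i
  · by_cases hnil : p = []
    · simp [applyMove, hnil] at h
    · have hpos := List.length_pos_iff.2 hnil
      refine ⟨p.length - 1, ?_, ?_⟩
      · rw [List.getD_eq_default p 0 (by omega : p.length ≤ p.length - 1 + 1)]
        exact Nat.pos_of_ne_zero (hp.resolve_left hnil)
      · rw [moveAt, if_neg (by omega)]
  · by_cases hc : i + 1 < p.length ∧ p.getD (i + 1) 0 < p.getD i 0
    · exact ⟨i, hc.2, by rw [moveAt, if_pos hc.1]⟩
    · simp only [applyMove, if_neg hc, reduceCtorEq] at h

lemma moveAt_inj {p : List ℕ} {i j : ℕ} (hi : i < p.length) (hj : j < p.length)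
    (h : moveAt p i = moveAt p j) : i = j := by
  unfold moveAt at h
  split_ifs at h
  · simpa using h
  · omega

lemma hasCount_zero {f : ℕ → ℕ} (hf : ∀ i, f i = 0) : HasCount f 1 := by
  rintro p ⟨hp, k, -, hk⟩
  obtain rfl : p = [] := by
    refine hp.resolve_right fun h => h ?_
    rw [← hk, hf]
  refine ⟨{[]}, by simp, fun ms => ?_⟩
  rcases ms with _ | ⟨m, ms⟩
  · simp [run]
  · rcases m with _ | i <;> simp [run, applyMove]

lemma hasCount_of_moves {f : ℕ → ℕ} {N : ℕ → ℚ} {D : Finset ℕ} (hf : ∃ i, f i ≠ 0)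
    (hD : ∀ j, f (j + 1) < f j → j ∈ D)
    (hlegal : ∀ j ∈ D, f (j + 1) < f j → HasCount (swapEat f j) (N j))
    (hillegal : ∀ j ∈ D, f j ≤ f (j + 1) → N j = 0) :
    HasCount f (∑ j ∈ D, N j) := by
  classical
  rintro p ⟨hp, k, h0, hk⟩
  have hnil : p ≠ [] := by
    rintro rfl
    obtain ⟨i, hi⟩ := hf
    by_cases hik : i < k
    · exact hi (h0 i hik)
    · obtain ⟨d, rfl⟩ : ∃ d, i = d + k := ⟨i - k, by omega⟩
      exact hi (by simp [hk])
  have hge : ∀ j, f (j + 1) < f j → ∃ i, j = i + k ∧ p.getD (i + 1) 0 < p.getD i 0 := by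
    intro j hj
    have : k ≤ j := by
      by_contra hjk
      have := h0 j (by omega)
      omega
    obtain ⟨i, rfl⟩ : ∃ i, j = i + k := ⟨j - k, by omega⟩
    refine ⟨i, rfl, ?_⟩
    rw [← hk, ← hk, show i + 1 + k = i + k + 1 by ring]
    exact hj
  have key : ∀ j ∈ D, ∃ s : Finset (List (Option ℕ)), (s.card : ℚ) = N j ∧
      ∀ ms, ms ∈ s ↔ f (j + 1) < f j ∧ run p (moveAt p (j - k) :: ms) = some [] := by
    intro j hj
    by_cases hd : f (j + 1) < f j
    · obtain ⟨i, rfl, hi⟩ := hge j hd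
      obtain ⟨l, hl, hl'⟩ := applyMove_moveAt hi
      have hrep : Represents (trim l) (swapEat f (i + k)) := by
        refine represents_trim (k := k) (fun n hn => ?_) (fun n => ?_)
        · have := h0 n hn
          simp only [swapEat]
          rw [if_neg (by omega), if_neg (by omega), this]
        · rw [hl']
          simp only [swapEat, ← hk]
          rw [show i + 1 + k = i + k + 1 by ring]
          split_ifs <;> omega
      obtain ⟨s, hs, hs'⟩ := hlegal _ hj hd _ hrep
      refine ⟨s, hs, fun ms => ?_⟩
      rw [hs']
      simp [run, hl, hd]
    · exact ⟨∅, by simp [hillegal j hj (by omega)], by simp [hd]⟩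
  choose! S hS hS' using key
  refine ⟨D.biUnion fun j => (S j).image (moveAt p (j - k) :: ·), ?_, fun ms => ?_⟩
  · rw [Finset.card_biUnion]
    · push_cast
      refine Finset.sum_congr rfl fun j hj => ?_
      rw [Finset.card_image_of_injective _ (List.cons_injective), hS j hj]
    · intro j hj j' hj' hne
      rw [Function.onFun, Finset.disjoint_left]
      intro ms h1 h2
      obtain ⟨t, ht, rfl⟩ := Finset.mem_image.1 h1
      obtain ⟨t', ht', heq⟩ := Finset.mem_image.1 h2
      obtain ⟨i, rfl, hi⟩ := hge j ((hS' j hj t).1 ht).1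
      obtain ⟨i', rfl, hi'⟩ := hge j' ((hS' j' hj' t').1 ht').1
      simp only [List.cons.injEq, Nat.add_sub_cancel] at heq
      have := moveAt_inj (lt_length_of_descent hi') (lt_length_of_descent hi) heq.1
      omega
  · simp only [Finset.mem_biUnion, Finset.mem_image]
    constructor
    · rintro ⟨j, hj, t, ht, rfl⟩
      exact ((hS' j hj t).1 ht).2
    · intro h
      rcases ms with _ | ⟨m, t⟩
      · simp [run, hnil] at h
      · have h' := h
        simp only [run, Option.bind_eq_some_iff] at h'
        obtain ⟨q, hq, -⟩ := h'
        obtain ⟨i, hi, rfl⟩ := exists_moveAt_of_applyMove hp hq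
        have hd : f (i + k + 1) < f (i + k) := by
          rw [show i + k + 1 = i + 1 + k by ring, hk, hk]
          exact hi
        refine ⟨i + k, hD _ hd, t, ?_, by simp⟩
        rw [hS' _ (hD _ hd)]
        exact ⟨hd, by simpa using h⟩

/-- Three piles, the `i`-th being at `pᵢ` and having `tᵢ - pᵢ` candies. -/
def threePiles (t₁ t₂ t₃ p₁ p₂ p₃ : ℕ) : ℕ → ℕ := fun i =>
  if i = p₁ then t₁ - p₁ else if i = p₂ then t₂ - p₂ else if i = p₃ then t₃ - p₃ else 0

lemma hasCount_threePiles {t₁ t₂ t₃ p₁ p₂ p₃ : ℕ} {x₁ x₂ x₃ : ℚ}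
    (h12 : p₁ < p₂) (h23 : p₂ < p₃) (hpos : p₁ < t₁ ∨ p₂ < t₂ ∨ p₃ < t₃)
    (h₁ : if threePiles t₁ t₂ t₃ p₁ p₂ p₃ (p₁ + 1) < t₁ - p₁ then
      HasCount (swapEat (threePiles t₁ t₂ t₃ p₁ p₂ p₃) p₁) x₁ else x₁ = 0)
    (h₂ : if threePiles t₁ t₂ t₃ p₁ p₂ p₃ (p₂ + 1) < t₂ - p₂ then
      HasCount (swapEat (threePiles t₁ t₂ t₃ p₁ p₂ p₃) p₂) x₂ else x₂ = 0)
    (h₃ : if p₃ < t₃ then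
      HasCount (swapEat (threePiles t₁ t₂ t₃ p₁ p₂ p₃) p₃) x₃ else x₃ = 0) :
    HasCount (threePiles t₁ t₂ t₃ p₁ p₂ p₃) (x₁ + x₂ + x₃) := by
  set f := threePiles t₁ t₂ t₃ p₁ p₂ p₃ with hf
  have e₁ : f p₁ = t₁ - p₁ := by simp [hf, threePiles]
  have e₂ : f p₂ = t₂ - p₂ := by simp [hf, threePiles, h12.ne']
  have e₃ : f p₃ = t₃ - p₃ := by simp [hf, threePiles, h23.ne', (h12.trans h23).ne']
  have e₄ : f (p₃ + 1) = 0 := by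
    simp only [hf, threePiles]
    rw [if_neg (by omega), if_neg (by omega), if_neg (by omega)]
  have hsum : x₁ + x₂ + x₃ = ∑ j ∈ ({p₁, p₂, p₃} : Finset ℕ),
      if j = p₁ then x₁ else if j = p₂ then x₂ else x₃ := by
    rw [Finset.sum_insert (by simp; omega), Finset.sum_insert (by simp; omega),
      Finset.sum_singleton]
    simp [h12.ne', h23.ne', (h12.trans h23).ne', add_assoc]
  rw [hsum]
  apply hasCount_of_moves
  · rcases hpos with h | h | h
    · exact ⟨p₁, by omega⟩
    · exact ⟨p₂, by omega⟩
    · exact ⟨p₃, by omega⟩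
  · intro j hj
    by_contra hn
    simp only [Finset.mem_insert, Finset.mem_singleton, not_or] at hn
    have : f j = 0 := by simp [hf, threePiles, hn]
    omega
  · intro j hj hd
    simp only [Finset.mem_insert, Finset.mem_singleton] at hj
    rcases hj with rfl | rfl | rfl
    · rw [e₁] at hd
      simpa [hd] using h₁
    · rw [e₂] at hd
      simpa [hd, h12.ne'] using h₂
    · rw [e₃, e₄] at hd
      simpa [show j < t₃ by omega, h23.ne', (h12.trans h23).ne'] using h₃
  · intro j hj hd
    simp only [Finset.mem_insert, Finset.mem_singleton] at hj
    rcases hj with rfl | rfl | rfl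
    · rw [e₁] at hd
      simpa [hd.not_gt] using h₁
    · rw [e₂] at hd
      simpa [hd.not_gt, h12.ne'] using h₂
    · rw [e₃, e₄] at hd
      simpa [show ¬ j < t₃ by omega, h23.ne', (h12.trans h23).ne'] using h₃

/-- The reciprocal of the factorial of an integer, vanishing at negative integers. -/
def invFactorial (k : ℤ) : ℚ := if k < 0 then 0 else (k.toNat.factorial : ℚ)⁻¹

lemma invFactorial_of_neg {k : ℤ} (h : k < 0) : invFactorial k = 0 := if_pos h

lemma invFactorial_natCast (n : ℕ) : invFactorial n = (n.factorial : ℚ)⁻¹ := by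
  simp [invFactorial]

lemma invFactorial_sub_one (k : ℤ) : invFactorial (k - 1) = k * invFactorial k := by
  rcases lt_trichotomy k 0 with h | rfl | h
  · rw [invFactorial_of_neg h, invFactorial_of_neg (by omega), mul_zero]
  · simp [invFactorial_of_neg]
  · obtain ⟨n, rfl⟩ : ∃ n : ℕ, k = n + 1 := ⟨(k - 1).toNat, by omega⟩
    rw [add_sub_cancel_right, invFactorial_natCast, ← Nat.cast_succ, invFactorial_natCast,
      Nat.factorial_succ]
    have := Nat.factorial_ne_zero n
    push_cast
    field_simp

lemma invFactorial_sub_add_one (t p : ℤ) :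
    invFactorial (t - (p + 1)) = (t - p) * invFactorial (t - p) := by
  rw [← sub_sub, invFactorial_sub_one]
  push_cast
  ring

/-- A 2 by 2 minor of the matrix of reciprocal factorials `1 / (tⱼ - pᵢ)!`. -/
def minor (s t p q : ℤ) : ℚ :=
  invFactorial (s - p) * invFactorial (t - q) - invFactorial (t - p) * invFactorial (s - q)

/-- The determinant of the matrix of reciprocal factorials `1 / (tⱼ - pᵢ)!`. -/
def orderedWeight (t₁ t₂ t₃ p₁ p₂ p₃ : ℤ) : ℚ :=
  invFactorial (t₁ - p₁) * minor t₂ t₃ p₂ p₃ - invFactorial (t₂ - p₁) * minor t₁ t₃ p₂ p₃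
    + invFactorial (t₃ - p₁) * minor t₁ t₂ p₂ p₃

/-- The analogue of `orderedWeight` when the first pile has to overtake the second one. -/
def crossingWeight (t₁ t₂ t₃ p₁ p₂ p₃ : ℤ) : ℚ :=
  invFactorial (t₁ - p₁) * minor t₂ t₃ p₂ p₃
    - invFactorial (t₁ + 1 - p₁) * minor (t₂ - 1) t₃ p₂ p₃
    + invFactorial (t₃ - p₁) * minor t₁ t₂ p₂ p₃
    - invFactorial (t₃ + 1 - p₁) * minor t₁ (t₂ - 1) p₂ p₃

lemma orderedWeight_recursion (t₁ t₂ t₃ p₁ p₂ p₃ : ℤ) :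
    ((t₁ + t₂ + t₃ - p₁ - p₂ - p₃ : ℤ) : ℚ) * orderedWeight t₁ t₂ t₃ p₁ p₂ p₃ =
      orderedWeight t₁ t₂ t₃ (p₁ + 1) p₂ p₃ + orderedWeight t₁ t₂ t₃ p₁ (p₂ + 1) p₃
        + orderedWeight t₁ t₂ t₃ p₁ p₂ (p₃ + 1) := by
  simp only [orderedWeight, minor, invFactorial_sub_add_one]
  push_cast
  ring

lemma crossingWeight_recursion (t₁ t₂ t₃ p₁ p₂ p₃ : ℤ) :
    ((t₁ + t₂ + t₃ - p₁ - p₂ - p₃ : ℤ) : ℚ) * crossingWeight t₁ t₂ t₃ p₁ p₂ p₃ =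
      crossingWeight t₁ t₂ t₃ (p₁ + 1) p₂ p₃ + crossingWeight t₁ t₂ t₃ p₁ (p₂ + 1) p₃
        + crossingWeight t₁ t₂ t₃ p₁ p₂ (p₃ + 1) := by
  simp only [crossingWeight, minor, invFactorial_sub_add_one]
  push_cast
  ring

lemma crossingWeight_collision (t₁ t₂ t₃ p q : ℤ) :
    crossingWeight t₁ t₂ t₃ (p + 1) (p + 1) q = orderedWeight (t₂ - 1) t₁ t₃ p (p + 1) q := by
  simp only [crossingWeight, orderedWeight, minor]
  rw [show t₁ + 1 - (p + 1) = t₁ - p by ring, show t₃ + 1 - (p + 1) = t₃ - p by ring,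
    show t₂ - 1 - p = t₂ - (p + 1) by ring]
  ring

lemma hasCount_ordered {t₁ t₂ t₃ : ℕ} (ht12 : t₁ < t₂) (ht23 : t₂ < t₃) (n : ℕ) :
    ∀ p₁ p₂ p₃ : ℕ, p₁ < p₂ → p₂ < p₃ → p₁ ≤ t₁ → p₂ ≤ t₂ → p₃ ≤ t₃ →
      t₁ + t₂ + t₃ = n + (p₁ + p₂ + p₃) →
      HasCount (threePiles t₁ t₂ t₃ p₁ p₂ p₃)
        (n.factorial * orderedWeight t₁ t₂ t₃ p₁ p₂ p₃) := by
  induction n with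
  | zero =>
    intro p₁ p₂ p₃ h12 h23 h1 h2 h3 hs
    obtain ⟨rfl, rfl, rfl⟩ : p₁ = t₁ ∧ p₂ = t₂ ∧ p₃ = t₃ := by omega
    have h := hasCount_zero (f := threePiles p₁ p₂ p₃ p₁ p₂ p₃) (by simp [threePiles])
    convert h using 1
    have z : invFactorial 0 = 1 := by simpa using invFactorial_natCast 0
    simp only [orderedWeight, minor, sub_self, z]
    rw [invFactorial_of_neg (by omega : (p₁ : ℤ) - p₂ < 0),
      invFactorial_of_neg (by omega : (p₁ : ℤ) - p₃ < 0),
      invFactorial_of_neg (by omega : (p₂ : ℤ) - p₃ < 0)]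
    simp
  | succ n ih =>
    intro p₁ p₂ p₃ h12 h23 h1 h2 h3 hs
    have hrec := orderedWeight_recursion t₁ t₂ t₃ p₁ p₂ p₃
    rw [show (t₁ + t₂ + t₃ - p₁ - p₂ - p₃ : ℤ) = ((n + 1 : ℕ) : ℤ) by omega] at hrec
    have hw : ((n + 1).factorial * orderedWeight t₁ t₂ t₃ p₁ p₂ p₃ : ℚ) =
        n.factorial * orderedWeight t₁ t₂ t₃ (p₁ + 1 : ℕ) p₂ p₃
        + n.factorial * orderedWeight t₁ t₂ t₃ p₁ (p₂ + 1 : ℕ) p₃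
        + n.factorial * orderedWeight t₁ t₂ t₃ p₁ p₂ (p₃ + 1 : ℕ) := by
      rw [Nat.factorial_succ]
      push_cast at hrec ⊢
      linear_combination (n.factorial : ℚ) * hrec
    rw [hw]
    apply hasCount_threePiles h12 h23 (by omega)
    · split_ifs with hd
      · have hne : p₁ + 1 ≠ p₂ := by
          rintro rfl
          simp [threePiles] at hd
          omega
        convert ih (p₁ + 1) p₂ p₃ (by omega) h23 (by omega) h2 h3 (by omega) using 1
        ext i
        simp only [threePiles, swapEat]
        split_ifs <;> omega
      · have : p₁ + 1 = p₂ ∨ p₁ = t₁ := by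
          simp only [threePiles] at hd
          split_ifs at hd <;> omega
        rw [mul_eq_zero]
        right
        rcases this with rfl | rfl
        · simp only [orderedWeight, minor]
          ring
        · simp only [orderedWeight, minor]
          rw [invFactorial_of_neg (by omega : (p₁ : ℤ) - (p₁ + 1 : ℕ) < 0),
            invFactorial_of_neg (by omega : (p₁ : ℤ) - p₂ < 0),
            invFactorial_of_neg (by omega : (p₁ : ℤ) - p₃ < 0)]
          ring
    · split_ifs with hd
      · have hne : p₂ + 1 ≠ p₃ := by
          rintro rfl
          simp only [threePiles] at hd
          split_ifs at hd <;> omega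
        convert ih p₁ (p₂ + 1) p₃ (by omega) (by omega) h1 (by omega) h3 (by omega) using 1
        ext i
        simp only [threePiles, swapEat]
        split_ifs <;> omega
      · have : p₂ + 1 = p₃ ∨ p₂ = t₂ := by
          simp only [threePiles] at hd
          split_ifs at hd <;> omega
        rw [mul_eq_zero]
        right
        rcases this with rfl | rfl
        · simp only [orderedWeight, minor]
          ring
        · simp only [orderedWeight, minor]
          rw [invFactorial_of_neg (by omega : (p₂ : ℤ) - (p₂ + 1 : ℕ) < 0),
            invFactorial_of_neg (by omega : (p₂ : ℤ) - p₃ < 0),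
            invFactorial_of_neg (by omega : (t₁ : ℤ) - (p₂ + 1 : ℕ) < 0),
            invFactorial_of_neg (by omega : (t₁ : ℤ) - p₃ < 0)]
          ring
    · split_ifs with hd
      · convert ih p₁ p₂ (p₃ + 1) h12 (by omega) h1 h2 (by omega) (by omega) using 1
        ext i
        simp only [threePiles, swapEat]
        split_ifs <;> omega
      · simp only [orderedWeight, minor]
        rw [invFactorial_of_neg (by omega : (t₁ : ℤ) - (p₃ + 1 : ℕ) < 0),
          invFactorial_of_neg (by omega : (t₂ : ℤ) - (p₃ + 1 : ℕ) < 0),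
          invFactorial_of_neg (by omega : (t₃ : ℤ) - (p₃ + 1 : ℕ) < 0)]
        ring

lemma hasCount_crossing {t₁ t₂ t₃ : ℕ} (ht21 : t₂ ≤ t₁) (ht13 : t₁ < t₃) (n : ℕ) :
    ∀ p₁ p₂ p₃ : ℕ, p₁ < p₂ → p₂ < p₃ → p₂ ≤ t₂ → p₃ ≤ t₃ →
      t₁ + t₂ + t₃ = n + (p₁ + p₂ + p₃) →
      HasCount (threePiles t₁ t₂ t₃ p₁ p₂ p₃)
        (n.factorial * crossingWeight t₁ t₂ t₃ p₁ p₂ p₃) := by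
  induction n with
  | zero => intros; omega
  | succ n ih =>
    intro p₁ p₂ p₃ h12 h23 h2 h3 hs
    have hrec := crossingWeight_recursion t₁ t₂ t₃ p₁ p₂ p₃
    rw [show (t₁ + t₂ + t₃ - p₁ - p₂ - p₃ : ℤ) = ((n + 1 : ℕ) : ℤ) by omega] at hrec
    have hw : ((n + 1).factorial * crossingWeight t₁ t₂ t₃ p₁ p₂ p₃ : ℚ) =
        n.factorial * crossingWeight t₁ t₂ t₃ (p₁ + 1 : ℕ) p₂ p₃
        + n.factorial * crossingWeight t₁ t₂ t₃ p₁ (p₂ + 1 : ℕ) p₃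
        + n.factorial * crossingWeight t₁ t₂ t₃ p₁ p₂ (p₃ + 1 : ℕ) := by
      rw [Nat.factorial_succ]
      push_cast at hrec ⊢
      linear_combination (n.factorial : ℚ) * hrec
    rw [hw]
    apply hasCount_threePiles h12 h23 (by omega)
    · rw [if_pos (by simp only [threePiles]; split_ifs <;> omega)]
      by_cases hne : p₁ + 1 = p₂
      · subst hne
        have h := hasCount_ordered (t₁ := t₂ - 1) (t₂ := t₁) (t₃ := t₃) (by omega) (by omega) n
          p₁ (p₁ + 1) p₃ (by omega) h23 (by omega) (by omega) h3 (by omega)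
        convert h using 1
        · ext i
          simp only [threePiles, swapEat]
          split_ifs <;> omega
        · rw [Nat.cast_succ, crossingWeight_collision, Nat.cast_pred (by omega)]
      · convert ih (p₁ + 1) p₂ p₃ (by omega) h23 h2 h3 (by omega) using 1
        ext i
        simp only [threePiles, swapEat]
        split_ifs <;> omega
    · split_ifs with hd
      · have hne : p₂ + 1 ≠ p₃ := by
          rintro rfl
          simp only [threePiles] at hd
          split_ifs at hd <;> omega
        convert ih p₁ (p₂ + 1) p₃ (by omega) (by omega) (by omega) h3 (by omega) using 1
        ext i
        simp only [threePiles, swapEat]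
        split_ifs <;> omega
      · have : p₂ + 1 = p₃ ∨ p₂ = t₂ := by
          simp only [threePiles] at hd
          split_ifs at hd <;> omega
        rw [mul_eq_zero]
        right
        rcases this with rfl | rfl
        · simp only [crossingWeight, minor]
          ring
        · simp only [crossingWeight, minor]
          rw [invFactorial_of_neg (by omega : (p₂ : ℤ) - (p₂ + 1 : ℕ) < 0),
            invFactorial_of_neg (by omega : (p₂ : ℤ) - p₃ < 0),
            invFactorial_of_neg (by omega : (p₂ : ℤ) - 1 - (p₂ + 1 : ℕ) < 0),
            invFactorial_of_neg (by omega : (p₂ : ℤ) - 1 - p₃ < 0)]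
          ring
    · split_ifs with hd
      · convert ih p₁ p₂ (p₃ + 1) h12 (by omega) h2 (by omega) (by omega) using 1
        ext i
        simp only [threePiles, swapEat]
        split_ifs <;> omega
      · simp only [crossingWeight, minor]
        rw [invFactorial_of_neg (by omega : (t₁ : ℤ) - (p₃ + 1 : ℕ) < 0),
          invFactorial_of_neg (by omega : (t₂ : ℤ) - (p₃ + 1 : ℕ) < 0),
          invFactorial_of_neg (by omega : (t₂ : ℤ) - 1 - (p₃ + 1 : ℕ) < 0),
          invFactorial_of_neg (by omega : (t₃ : ℤ) - (p₃ + 1 : ℕ) < 0)]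
        ring

lemma numPlays_eq_of_hasCount {p : List ℕ} {f : ℕ → ℕ} {x : ℚ} (hp : Represents p f)
    (h : HasCount f x) : (numPlays p : ℚ) = x := by
  obtain ⟨s, hs, hs'⟩ := h p hp
  rw [← hs, numPlays, ← Nat.card_eq_finsetCard s]
  exact congrArg _ (Nat.card_congr (Equiv.subtypeEquivRight fun ms => (hs' ms).symm))

theorem stanley_solitaire_bca_formula (a b c : ℕ) (hcb : c ≤ b) (hba : b ≤ a) (hc : 0 < c) :
    (numPlays [b, c, a] : ℚ) =
      (Nat.factorial (a + b + c) : ℚ) /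
        ((Nat.factorial (a + 3) : ℚ) * (Nat.factorial (b + 1) : ℚ) * (Nat.factorial c : ℚ)) *
      ((a : ℚ) ^ 2 * b - (a : ℚ) ^ 2 * c + (a : ℚ) * (b : ℚ) ^ 2 - 2 * a * b * c
        + (a : ℚ) * (c : ℚ) ^ 2 - (b : ℚ) ^ 2 * c + (b : ℚ) * (c : ℚ) ^ 2
        + (a : ℚ) ^ 2 + 5 * (a : ℚ) * b - 6 * (a : ℚ) * c + 3 * (b : ℚ) ^ 2
        - 6 * (b : ℚ) * c + 3 * (c : ℚ) ^ 2 + 4 * (a : ℚ) + 6 * (b : ℚ) - 9 * (c : ℚ) + 3) *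
      ((a : ℚ) - (b : ℚ) + 2) := by
  have hrep : Represents [b, c, a] (threePiles b (c + 1) (a + 2) 0 1 2) := by
    refine ⟨Or.inr (by simp; omega), 0, by simp, fun i => ?_⟩
    rcases i with _ | _ | _ | i <;> simp [threePiles]
  have e (x y : ℤ) (h : y = x - 1) : invFactorial y = x * invFactorial x := by
    rw [h, invFactorial_sub_one]
  have ea3 : invFactorial (a + 3) = ((a + 3).factorial : ℚ)⁻¹ :=
    mod_cast invFactorial_natCast (a + 3)
  have eb1 : invFactorial (b + 1) = ((b + 1).factorial : ℚ)⁻¹ :=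
    mod_cast invFactorial_natCast (b + 1)
  have ec := invFactorial_natCast c
  have ea2 := e (a + 3) (a + 2) (by ring)
  have ea1 := e (a + 2) (a + 1) (by ring)
  have ea := e (a + 1) a (by ring)
  have eb := e (b + 1) b (by ring)
  have eb' := e b (b - 1) (by ring)
  have eb'' := e (b - 1) (b - 2) (by ring)
  have ec' := e c (c - 1) (by ring)
  have ec'' := e (c - 1) (c - 2) (by ring)
  have n1 := Nat.factorial_ne_zero (a + 3)
  have n2 := Nat.factorial_ne_zero (b + 1)
  have n3 := Nat.factorial_ne_zero c
  rcases hcb.eq_or_lt with rfl | hlt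
  · rw [numPlays_eq_of_hasCount hrep (hasCount_ordered (by omega) (by omega) (a + c + c) 0 1 2
      (by omega) (by omega) (by omega) (by omega) (by omega) (by omega))]
    simp only [orderedWeight, minor]
    push_cast
    rw [show (c : ℤ) - 0 = c by ring, show (c + 1 : ℤ) - 0 = c + 1 by ring,
      show (a + 2 : ℤ) - 0 = a + 2 by ring, show (c + 1 : ℤ) - 1 = c by ring,
      show (a + 2 : ℤ) - 1 = a + 1 by ring, show (c + 1 : ℤ) - 2 = c - 1 by ring,
      show (a + 2 : ℤ) - 2 = a by ring]
    rw [eb'', eb', eb, ea, ea1, ea2, ea3, eb1]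
    rw [Nat.factorial_succ c] at *
    push_cast
    field_simp
    ring
  · rw [numPlays_eq_of_hasCount hrep (hasCount_crossing (by omega) (by omega) (a + b + c) 0 1 2
      (by omega) (by omega) (by omega) (by omega) (by omega))]
    simp only [crossingWeight, minor]
    push_cast
    rw [show (b : ℤ) - 0 = b by ring, show (b + 1 : ℤ) - 0 = b + 1 by ring,
      show (a + 2 : ℤ) - 0 = a + 2 by ring, show (a + 2 + 1 : ℤ) - 0 = a + 3 by ring,
      show (c + 1 : ℤ) - 1 = c by ring,
      show (a + 2 : ℤ) - 1 = a + 1 by ring, show (c + 1 : ℤ) - 2 = c - 1 by ring,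
      show (a + 2 : ℤ) - 2 = a by ring]
    rw [eb'', eb', eb, ec'', ec', ea, ea1, ea2, ea3, eb1, ec]
    push_cast
    field_simp
    ring
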